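/- arXiv:1308.1499 — 3 statements merged into one kernel-verified Lean document; each statement's English description precedes it below -/
import Mathlib

section
/- Let G be a discrete group, A a subset of G and n a positive integer. The following are equivalent: (i) |ϑ_p(A)| ≤ n for every free ultrafilter p ∈ G*; (ii) for all pairwise distinct x₁, ..., x_{n+1} ∈ G, the set x₁A ∩ ... ∩ x_{n+1}A is finite; (iii) A is n-thin. -/
open Pointwise

/-- The extension of the group multiplication to `βG`, the space of ultrafilters on `G`:
`A ∈ uMul p q ↔ {g : g⁻¹A ∈ q} ∈ p`. -/
def uMul {G : Type*} [Group G] (p q : Ultrafilter G) : Ultrafilter G :=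
  p.bind fun g => q.map (g * ·)

/-- An ultrafilter is free if it is not principal. -/
def uFree {G : Type*} (p : Ultrafilter G) : Prop := ∀ g : G, p ≠ pure g

/-- `A* = Ā ∩ G*`, the set of free ultrafilters containing `A`. -/
def uStar {G : Type*} (A : Set G) : Set (Ultrafilter G) := {p | A ∈ p ∧ uFree p}

/-- `Gp = {gp : g ∈ G}`. -/
def uOrbit {G : Type*} [Group G] (p : Ultrafilter G) : Set (Ultrafilter G) :=
  {q | ∃ g : G, q = uMul (pure g) p}

/-- The `p`-companion of `A`: `ϑ_p(A) = A* ∩ Gp`. -/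
def uCompanion {G : Type*} [Group G] (A : Set G) (p : Ultrafilter G) : Set (Ultrafilter G) :=
  uStar A ∩ uOrbit p

/-- A set is sparse if all its ultracompanions are finite. -/
def uSparse {G : Type*} [Group G] (A : Set G) : Prop :=
  ∀ p : Ultrafilter G, uFree p → (uCompanion A p).Finite

/-- A set is disparse if all its ultracompanions are discrete subspaces of `βG`. -/
def uDisparse {G : Type*} [Group G] (A : Set G) : Prop :=
  ∀ p : Ultrafilter G, uFree p → DiscreteTopology (uCompanion A p)

/-- `A` is large if `G = FA` for some finite `F`. -/
def uLarge {G : Type*} [Group G] (A : Set G) : Prop :=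
  ∃ F : Set G, F.Finite ∧ (Set.univ : Set G) = F * A

/-- `A` is thick if every finite set has a right translate inside `A` with translating
element from `A`. -/
def uThick {G : Type*} [Group G] (A : Set G) : Prop :=
  ∀ F : Set G, F.Finite → ∃ a ∈ A, (· * a) '' F ⊆ A

/-- `A` is prethick if `FA` is thick for some finite `F`. -/
def uPrethick {G : Type*} [Group G] (A : Set G) : Prop :=
  ∃ F : Set G, F.Finite ∧ uThick (F * A)

/-- `A` is small if `L \ A` is large for every large `L`. -/
def uSmall {G : Type*} [Group G] (A : Set G) : Prop :=
  ∀ L : Set G, uLarge L → uLarge (L \ A)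

/-- `A` is thin if `gA ∩ A` is finite for all `g ≠ e`. -/
def uThin {G : Type*} [Group G] (A : Set G) : Prop :=
  ∀ g : G, g ≠ 1 → (g • A ∩ A).Finite

/-- `FP(a_n) = {a_{i₁} ⋯ a_{i_n} : i₁ < ⋯ < i_n}`. -/
def uFP {G : Type*} [Group G] (a : ℕ → G) : Set G :=
  {g | ∃ l : List ℕ, l ≠ [] ∧ l.Pairwise (· < ·) ∧ g = (l.map a).prod}

lemma mem_uMul_pure {G : Type*} [Group G] (g : G) (p : Ultrafilter G) (B : Set G) :
    B ∈ uMul (pure g) p ↔ (g * ·) ⁻¹' B ∈ p := Iff.rfl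

lemma exists_inj_of_lt {α : Type*} (s : Set α) (n : ℕ) (h : ¬ s.encard ≤ (n : ℕ∞)) :
    ∃ x : Fin (n + 1) → α, Function.Injective x ∧ ∀ i, x i ∈ s := by
  have h1 : ((n + 1 : ℕ) : ℕ∞) ≤ s.encard := by
    have := Order.add_one_le_of_lt (not_le.mp h)
    exact_mod_cast this
  obtain ⟨t, hts, ht⟩ := Set.exists_subset_encard_eq h1
  have hfin : t.Finite := Set.finite_of_encard_eq_coe ht
  lift t to Finset α using hfin
  have hc : t.card = n + 1 := by
    rw [Set.encard_coe_eq_coe_finsetCard] at ht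
    exact_mod_cast ht
  refine ⟨fun i => ((t.equivFinOfCardEq hc).symm i : α), ?_, ?_⟩
  · intro i j hij
    exact (t.equivFinOfCardEq hc).symm.injective (Subtype.ext hij)
  · intro i
    exact hts ((t.equivFinOfCardEq hc).symm i).2

lemma not_le_of_inj {α : Type*} (s : Set α) (n : ℕ) (x : Fin (n + 1) → α)
    (hx : Function.Injective x) (hs : ∀ i, x i ∈ s) : ¬ s.encard ≤ (n : ℕ∞) := by
  intro h
  have h1 : (Set.range x).encard ≤ s.encard :=
    Set.encard_le_encard (by rintro _ ⟨i, rfl⟩; exact hs i)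
  rw [← Set.image_univ, hx.encard_image, Set.encard_univ] at h1
  simp only [ENat.card_eq_coe_fintype_card, Fintype.card_fin] at h1
  have h2 := h1.trans h
  have h3 : n + 1 ≤ n := by exact_mod_cast h2
  omega

lemma exists_indep {G : Type*} [Group G] (g : G) (hg : g ≠ 1) :
    ∃ B : Set G, (∀ b ∈ B, g * b ∉ B) ∧ ∀ x, x ∈ B ∨ g * x ∈ B ∨ g⁻¹ * x ∈ B := by
  obtain ⟨B, hB⟩ := zorn_subset {B : Set G | ∀ b ∈ B, g * b ∉ B} (by
    intro c hc hch
    refine ⟨⋃₀ c, ?_, fun s hs => Set.subset_sUnion_of_mem hs⟩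
    rintro b ⟨s, hs, hbs⟩ ⟨t, ht, hbt⟩
    rcases hch.total hs ht with h | h
    · exact hc ht b (h hbs) hbt
    · exact hc hs b hbs (h hbt))
  refine ⟨B, hB.prop, fun x => ?_⟩
  by_contra! hx
  obtain ⟨h1, h2, h3⟩ := hx
  refine h1 (hB.le_of_ge (y := insert x B) ?_ (Set.subset_insert x B) (Set.mem_insert x B))
  rintro b (rfl | hb) (h | h)
  · exact hg (mul_eq_right.mp h)
  · exact h2 h
  · apply h3
    rw [← h]
    simpa using hb
  · exact hB.prop b hb h

lemma uMul_pure_ne {G : Type*} [Group G] (g : G) (hg : g ≠ 1) (p : Ultrafilter G)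
    (h : ∀ B : Set G, (g * ·) ⁻¹' B ∈ p ↔ B ∈ p) : False := by
  obtain ⟨B, hB, hc⟩ := exists_indep g hg
  have key : B ∉ p := fun hp => by
    have h2 := (h B).mpr hp
    obtain ⟨x, hx1, hx2⟩ := p.nonempty_of_mem (Filter.inter_mem hp h2)
    exact hB x hx1 hx2
  have key2 : (g * ·) ⁻¹' B ∉ p := fun hp => key ((h B).mp hp)
  have key3 : (g⁻¹ * ·) ⁻¹' B ∉ p := fun hp => key (by
    have := (h _).mpr hp
    simpa [Set.preimage_preimage] using this)
  have hu : B ∪ ((g * ·) ⁻¹' B ∪ (g⁻¹ * ·) ⁻¹' B) ∈ p :=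
    Filter.mem_of_superset Filter.univ_mem (fun x _ => hc x)
  rw [Ultrafilter.union_mem_iff, Ultrafilter.union_mem_iff] at hu
  tauto

lemma uMul_pure_inj {G : Type*} [Group G] (p : Ultrafilter G) (g k : G)
    (h : uMul (pure g) p = uMul (pure k) p) : g = k := by
  by_contra hne
  refine uMul_pure_ne (k⁻¹ * g) (fun h1 => hne (inv_mul_eq_one.mp h1).symm) p fun B => ?_
  have h2 : (k⁻¹ * ·) ⁻¹' B ∈ uMul (pure g) p ↔ (k⁻¹ * ·) ⁻¹' B ∈ uMul (pure k) p := by rw [h]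
  rw [mem_uMul_pure, mem_uMul_pure] at h2
  simpa [Set.preimage_preimage, mul_assoc] using h2

lemma not_finite_of_free {G : Type*} (p : Ultrafilter G) (hp : uFree p) (s : Set G)
    (hs : s ∈ p) : ¬ s.Finite := fun hf => by
  obtain ⟨x, _, hx⟩ := Ultrafilter.eq_pure_of_finite_mem hf hs
  exact hp x hx

lemma uFree_uMul {G : Type*} [Group G] (p : Ultrafilter G) (hp : uFree p) (g : G) :
    uFree (uMul (pure g) p) := by
  intro x hx
  have h1 : ({x} : Set G) ∈ uMul (pure g) p := by
    rw [hx]; exact Ultrafilter.mem_pure.mpr rfl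
  rw [mem_uMul_pure] at h1
  exact not_finite_of_free p hp _ h1
    ((Set.finite_singleton x).preimage (mul_right_injective g).injOn)

lemma exists_free {G : Type*} (s : Set G) (hs : s.Infinite) :
    ∃ p : Ultrafilter G, uFree p ∧ s ∈ p := by
  have : (Filter.cofinite ⊓ Filter.principal s).NeBot := Filter.cofinite_inf_principal_neBot_iff.mpr hs
  refine ⟨Ultrafilter.of (Filter.cofinite ⊓ Filter.principal s), ?_, ?_⟩
  · intro g hg
    have h1 : ({g}ᶜ : Set G) ∈ Ultrafilter.of (Filter.cofinite ⊓ Filter.principal s) :=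
      Ultrafilter.of_le _ (Filter.mem_inf_of_left (Set.finite_singleton g).compl_mem_cofinite)
    rw [hg] at h1
    exact (Ultrafilter.mem_pure.mp h1) rfl
  · exact Ultrafilter.of_le _ (Filter.mem_inf_of_right (Filter.mem_principal_self s))

/-- Proposition 4: three characterizations of `n`-thin sets. -/
theorem statement8 {G : Type*} [Group G] (A : Set G) (n : ℕ) (hn : 0 < n) :
    ((∀ p : Ultrafilter G, uFree p → (uCompanion A p).encard ≤ (n : ℕ∞))
      ↔ (∀ x : Fin (n + 1) → G, Function.Injective x → (⋂ i, x i • A).Finite))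
    ∧ ((∀ x : Fin (n + 1) → G, Function.Injective x → (⋂ i, x i • A).Finite)
      ↔ (∀ F : Set G, F.Finite → ∃ H : Set G, H.Finite ∧
          ∀ g : G, g ∉ H → ((· * g) '' F ∩ A).encard ≤ (n : ℕ∞))) := by
  refine ⟨⟨?_, ?_⟩, ⟨?_, ?_⟩⟩
  · intro h x hx
    by_contra hinf
    obtain ⟨p, hp, hs⟩ := exists_free _ hinf
    refine not_le_of_inj _ n (fun i => uMul (pure (x i)⁻¹) p) ?_ ?_ (h p hp)
    · intro i j hij
      exact hx (inv_injective (uMul_pure_inj p _ _ hij))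
    · intro i
      refine ⟨⟨?_, uFree_uMul p hp _⟩, _, rfl⟩
      rw [mem_uMul_pure]
      refine Filter.mem_of_superset hs fun y hy => ?_
      have := Set.mem_iInter.mp hy i
      rw [Set.mem_smul_set_iff_inv_smul_mem] at this
      exact this
  · intro h p hp
    by_contra hc
    obtain ⟨q, hq, hqm⟩ := exists_inj_of_lt _ n hc
    choose g hg using fun i => (hqm i).2
    have hgi : Function.Injective fun i => (g i)⁻¹ := by
      intro i j hij
      have hij' : g i = g j := inv_injective hij
      apply hq
      rw [hg i, hg j, hij']
    refine not_finite_of_free p hp _ ?_ (h _ hgi)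
    refine (Filter.iInter_mem (f := (p : Filter G))).mpr fun i => ?_
    have h1 := (hqm i).1.1
    rw [hg i, mem_uMul_pure] at h1
    refine Filter.mem_of_superset h1 fun y hy => ?_
    rw [Set.mem_smul_set_iff_inv_smul_mem, inv_inv]
    exact hy
  · intro h F hF
    have hfin : {x : Fin (n + 1) → G | Function.Injective x ∧ ∀ i, x i ∈ F}.Finite :=
      (Set.Finite.pi' fun _ => hF).subset fun x hx => hx.2
    refine ⟨⋃ x ∈ {x : Fin (n + 1) → G | Function.Injective x ∧ ∀ i, x i ∈ F},
      ⋂ i, (x i)⁻¹ • A, hfin.biUnion fun x hx => h (fun i => (x i)⁻¹) ?_, ?_⟩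
    · exact inv_injective.comp hx.1
    · intro g hg
      by_contra hc
      obtain ⟨y, hy, hym⟩ := exists_inj_of_lt _ n hc
      choose f hf hfy using fun i => (hym i).1
      apply hg
      refine Set.mem_biUnion (x := f) ⟨?_, hf⟩ ?_
      · intro i j hij
        apply hy
        rw [← hfy i, ← hfy j, hij]
      · refine Set.mem_iInter.mpr fun i => ?_
        rw [Set.mem_smul_set_iff_inv_smul_mem, inv_inv]
        have := (hym i).2
        rw [← hfy i] at this
        exact this
  · intro h x hx
    obtain ⟨H, hH, hb⟩ := h (Set.range fun i => (x i)⁻¹) (Set.finite_range _)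
    refine hH.subset fun g hg => ?_
    by_contra hgH
    refine not_le_of_inj _ n (fun i => (x i)⁻¹ * g) ?_ ?_ (hb g hgH)
    · intro i j hij
      exact hx (inv_injective (mul_left_injective g hij))
    · intro i
      refine ⟨⟨_, ⟨i, rfl⟩, rfl⟩, ?_⟩
      have := Set.mem_iInter.mp hg i
      rw [Set.mem_smul_set_iff_inv_smul_mem] at this
      exact this
end

section
/- Let G be a discrete group and A a subset of G. Then A is disparse if and only if for every p ∈ A* one has p ∉ G*p, i.e. there is no q ∈ G* with qp = p. -/
open Pointwise

theorem aux_mem {G : Type*} [Group G] (p q : Ultrafilter G) (A : Set G) :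
    A ∈ uMul p q ↔ ∀ᶠ g in (p : Filter G), A ∈ uMul (pure g) q := Iff.rfl

theorem aux_mem_pure {G : Type*} [Group G] (g : G) (q : Ultrafilter G) (A : Set G) :
    A ∈ uMul (pure g) q ↔ {x | g * x ∈ A} ∈ q := Iff.rfl

theorem aux_assoc {G : Type*} [Group G] (g h : G) (q : Ultrafilter G) :
    uMul (pure g) (uMul (pure h) q) = uMul (pure (g * h)) q := by
  ext A
  simp only [aux_mem_pure, Set.mem_ofPred_eq, mul_assoc]

theorem aux_one {G : Type*} [Group G] (q : Ultrafilter G) : uMul (pure 1) q = q := by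
  ext A
  simp [aux_mem_pure]

theorem aux_stab {G : Type*} [Group G] (k : G) (p : Ultrafilter G)
    (h : uMul (pure k) p = p) : k = 1 := by
  by_contra hk
  obtain ⟨S, hS⟩ := zorn_subset {S : Set G | ∀ x ∈ S, k * x ∉ S} (by
    intro c hc hch
    refine ⟨⋃₀ c, ?_, fun s hs => Set.subset_sUnion_of_mem hs⟩
    rintro x ⟨s, hs, hx⟩ ⟨t, ht, hx'⟩
    rcases hch.total hs ht with hst | hst
    · exact hc ht x (hst hx) hx'
    · exact hc hs x hx (hst hx'))
  have hS1 : ∀ x ∈ S, k * x ∉ S := hS.prop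
  have key : ∀ B : Set G, B ∈ p ↔ {x | k * x ∈ B} ∈ p := by
    intro B
    rw [← aux_mem_pure, h]
  have hcov : ∀ x, x ∈ S ∨ k * x ∈ S ∨ k⁻¹ * x ∈ S := by
    intro x
    by_contra! hx
    obtain ⟨h1, h2, h3⟩ := hx
    have : insert x S ⊆ S := hS.le_of_ge (y := insert x S) (by
      rintro y (rfl | hy) (h4 | h4)
      · exact hk (by simpa using h4)
      · exact h2 h4
      · exact h3 (by rw [← h4]; simpa using hy)
      · exact hS1 y hy h4) (Set.subset_insert _ _)
    exact h1 (this (Set.mem_insert _ _))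
  have hSp : S ∈ p := by
    have hu : S ∪ ({x | k * x ∈ S} ∪ {x | k⁻¹ * x ∈ S}) ∈ p :=
      Filter.mem_of_superset Filter.univ_mem fun x _ => hcov x
    rcases Ultrafilter.union_mem_iff.1 hu with h1 | h1
    · exact h1
    rcases Ultrafilter.union_mem_iff.1 h1 with h1 | h1
    · exact (key S).2 h1
    · simpa using (key _).1 h1
  obtain ⟨x, hx, hx'⟩ := p.nonempty_of_mem (Filter.inter_mem hSp ((key S).1 hSp))
  exact hS1 x hx hx'

theorem aux_free {G : Type*} [Group G] (g : G) (p : Ultrafilter G) (hp : uFree p) :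
    uFree (uMul (pure g) p) := by
  intro x hx
  apply hp (g⁻¹ * x)
  have : uMul (pure g⁻¹) (uMul (pure g) p) = uMul (pure g⁻¹) (pure x) := by rw [hx]
  rw [aux_assoc, inv_mul_cancel, aux_one] at this
  rw [this]
  rfl

open Topology

/-- Proposition 8: `A` is disparse iff `p ∉ G*p` for every `p ∈ A*`. -/
theorem statement13 {G : Type*} [Group G] (A : Set G) :
    uDisparse A ↔ ∀ p : Ultrafilter G, p ∈ uStar A →
      ¬∃ q : Ultrafilter G, uFree q ∧ uMul q p = p := by
  constructor
  · rintro hA p hp ⟨q, hq, hqp⟩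
    have hd := discreteTopology_subtype_iff.1 (hA p hp.2) p ⟨hp, 1, (aux_one p).symm⟩
    have hq1 : ∀ᶠ k in (q : Filter G), k ≠ 1 := by
      by_contra hcon
      rw [← Ultrafilter.eventually_not] at hcon
      apply hq 1
      apply Ultrafilter.coe_le_coe.1
      have : ({1} : Set G) ∈ q := by
        filter_upwards [hcon] with k hk
        simpa using hk
      exact Filter.le_pure_iff.2 this
    have ht : Filter.Tendsto (fun k => uMul (pure k) p) q (𝓝[≠] p ⊓ Filter.principal (uCompanion A p)) := by
      refine Filter.tendsto_inf.2 ⟨tendsto_nhdsWithin_iff.2 ⟨?_, ?_⟩, Filter.tendsto_principal.2 ?_⟩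
      · rw [(ultrafilterBasis_is_basis.nhds_hasBasis).tendsto_right_iff]
        rintro _ ⟨⟨U, rfl⟩, hU⟩
        have hU' : U ∈ p := hU
        rw [← hqp] at hU'
        exact hU'
      · filter_upwards [hq1] with k hk hk'
        exact hk (aux_stab k p hk')
      · have hU' : A ∈ p := hp.1
        rw [← hqp, aux_mem] at hU'
        filter_upwards [hU'] with k hk
        exact ⟨⟨hk, aux_free k p hp.2⟩, k, rfl⟩
    rw [hd] at ht
    exact q.neBot.ne (Filter.map_eq_bot_iff.1 (le_bot_iff.1 ht))
  · intro h p hp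
    refine discreteTopology_subtype_iff.2 ?_
    rintro r ⟨hr, g, hg⟩
    by_contra hne
    have hN : (𝓝[≠] r ⊓ Filter.principal (uCompanion A p)).NeBot := ⟨hne⟩
    have hC : (Filter.comap (fun k => uMul (pure k) r) (𝓝[≠] r)).NeBot := by
      refine Filter.comap_neBot fun t ht => ?_
      obtain ⟨s, hs1, -, k, rfl⟩ := hN.nonempty_of_mem
        (Filter.inter_mem_inf ht (Filter.mem_principal_self _))
      refine ⟨k * g⁻¹, ?_⟩
      rw [hg, aux_assoc]
      simpa using hs1
    have hq := Filter.tendsto_iff_comap.2 (Ultrafilter.of_le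
      (Filter.comap (fun k => uMul (pure k) r) (𝓝[≠] r)))
    set q := Ultrafilter.of (Filter.comap (fun k => uMul (pure k) r) (𝓝[≠] r))
    rw [tendsto_nhdsWithin_iff] at hq
    have hqr : uMul q r = r := by
      apply Ultrafilter.coe_le_coe.1
      intro U hU
      exact hq.1 ((ultrafilter_isOpen_basic U).mem_nhds hU)
    refine h r hr ⟨q, ?_, hqr⟩
    intro k hk
    have h2 := hq.2
    rw [hk] at h2 hqr
    exact h2 hqr
end

section
/- Let G be the direct sum (restricted direct product) of a family {G_α : α < κ} of countable groups. Then G can be partitioned into countably many (ℵ₀) disparse subsets. -/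
open Pointwise

/-- The restricted direct product (direct sum) of a family of groups: the subgroup of the
full product consisting of elements with all but finitely many coordinates equal to `1`. -/
def restrictedDirectProduct (κ : Type*) (Gf : κ → Type*) [∀ i, Group (Gf i)] :
    Subgroup (∀ i, Gf i) where
  carrier := {f | {i | f i ≠ 1}.Finite}
  mul_mem' := fun {f g} hf hg => (hf.union hg).subset (fun i hi => by
    by_contra hcon
    simp only [Set.mem_union, Set.mem_setOf_eq, not_or, not_not] at hcon
    exact hi (by simp [hcon.1, hcon.2]))
  one_mem' := by simp
  inv_mem' := fun {f} hf => hf.subset (fun i hi => by simpa using hi)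

theorem uMul_pure_eq {G : Type*} [Group G] (g : G) (p : Ultrafilter G) :
    uMul (pure g) p = p.map (g * ·) := by
  ext s
  show s ∈ Filter.bind (pure g) _ ↔ _
  rw [Filter.pure_bind]
  rfl

theorem uDisparse_of_sep {G : Type*} [Group G] (A : Set G)
    (h : ∀ q : Ultrafilter G, A ∈ q → ∃ B ∈ q, ∀ t : G, B ∈ q.map (t * ·) → t = 1) :
    uDisparse A := by
  intro p _
  rw [discreteTopology_subtype_iff']
  rintro q ⟨⟨hA, hq⟩, g, hg⟩
  obtain ⟨B, hB, hsep⟩ := h q hA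
  refine ⟨{u | B ∈ u}, ultrafilter_isOpen_basic B, ?_⟩
  ext r
  constructor
  · rintro ⟨hr, _, g', hg'⟩
    have hr' : r = q.map ((g' * g⁻¹) * ·) := by
      rw [hg', hg, uMul_pure_eq, uMul_pure_eq, Ultrafilter.map_map]
      congr 1
      funext x
      simp [mul_assoc]
    have h1 := hsep (g' * g⁻¹) (by rw [← hr']; exact hr)
    have : r = q := by
      rw [hr', h1]
      have : (fun x : G => 1 * x) = id := by funext x; simp
      rw [this, Ultrafilter.map_id]
    exact this
  · rintro rfl
    exact ⟨hB, ⟨hA, hq⟩, g, hg⟩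

theorem sep_restricted (κ : Type*) (Gf : κ → Type*) [∀ i, Group (Gf i)]
    (n : ℕ) (T : ∀ i, Set (Gf i)) (hT : ∀ i, (T i).Finite)
    (A : Set (restrictedDirectProduct κ Gf))
    (hA1 : ∀ x ∈ A, {i | x.1 i ≠ 1}.ncard = n)
    (hA2 : ∀ x ∈ A, ∀ i, x.1 i ∈ T i)
    (q : Ultrafilter (restrictedDirectProduct κ Gf)) (hq : A ∈ q) :
    ∃ B ∈ q, ∀ t, B ∈ q.map (t * ·) → t = 1 := by
  have hlim : ∀ i, ∃ v : Gf i, {x : restrictedDirectProduct κ Gf | x.1 i = v} ∈ q := by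
    intro i
    have h1 : (⋃ v ∈ T i, {x : restrictedDirectProduct κ Gf | x.1 i = v}) ∈ q := by
      refine Filter.mem_of_superset hq fun x hx => ?_
      simp only [Set.mem_iUnion]
      exact ⟨x.1 i, hA2 x hx i, rfl⟩
    obtain ⟨v, _, hv⟩ := (Ultrafilter.finite_biUnion_mem_iff (hT i)).1 h1
    exact ⟨v, hv⟩
  choose h hh using hlim
  have hfin : ∀ S : Set κ, S.Finite →
      {x : restrictedDirectProduct κ Gf | ∀ i ∈ S, x.1 i = h i} ∈ q := by
    intro S hS
    have : (⋂ i ∈ S, {x : restrictedDirectProduct κ Gf | x.1 i = h i}) ∈ q :=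
      (Filter.biInter_mem hS).2 fun i _ => hh i
    refine Filter.mem_of_superset this fun x hx => ?_
    simpa using hx
  have hSfin : {i | h i ≠ 1}.Finite := by
    by_contra hinf
    obtain ⟨F, hF, hcard⟩ := Set.Infinite.exists_subset_card_eq hinf (n + 1)
    obtain ⟨x, hx, hxA⟩ := q.nonempty_of_mem (Filter.inter_mem (hfin F F.finite_toSet) hq)
    have hsub : (F : Set κ) ⊆ {i | x.1 i ≠ 1} := by
      intro i hi
      have := hF hi
      simp only [Set.mem_setOf_eq] at this ⊢
      rw [hx i hi]
      exact this
    have := Set.ncard_le_ncard hsub x.2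
    rw [hA1 x hxA, Set.ncard_coe_finset, hcard] at this
    omega
  refine ⟨A ∩ {x | ∀ i ∈ {i | h i ≠ 1}, x.1 i = h i}, Filter.inter_mem hq (hfin _ hSfin), ?_⟩
  intro t ht
  rw [Ultrafilter.mem_map] at ht
  obtain ⟨x, ⟨htA, htS⟩, hxA, hxS, hxF⟩ := q.nonempty_of_mem (Filter.inter_mem ht
    (Filter.inter_mem hq (Filter.inter_mem (hfin _ hSfin) (hfin {i | t.1 i ≠ 1} t.2))))
  have key : ∀ i, x.1 i ≠ 1 → t.1 i * x.1 i = x.1 i := by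
    intro i hi
    by_cases hti : t.1 i = 1
    · rw [hti, one_mul]
    · have h1 := hxF i hti
      have h2 : h i ≠ 1 := by rw [← h1]; exact hi
      have h3 : t.1 i * x.1 i = h i := htS i h2
      rw [h3, h1]
  have hsub : {i | x.1 i ≠ 1} ⊆ {i | (t * x).1 i ≠ 1} := by
    intro i hi
    show t.1 i * x.1 i ≠ 1
    rw [key i hi]
    exact hi
  have heq := Set.eq_of_subset_of_ncard_le hsub
    (by rw [hA1 _ hxA, hA1 _ htA]) (t * x).2
  apply Subtype.ext
  funext i
  show t.1 i = 1
  by_cases hi : x.1 i = 1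
  · have h1 : i ∉ {i | (t * x).1 i ≠ 1} := by rw [← heq]; simpa using hi
    have h2 : t.1 i * x.1 i = 1 := by
      by_contra hne
      exact h1 hne
    rwa [hi, mul_one] at h2
  · exact mul_eq_right.1 (key i hi)

/-- Proposition 13: a direct sum of countable groups can be partitioned into countably
many disparse subsets. -/
theorem statement18 (κ : Type*) (Gf : κ → Type*) [∀ i, Group (Gf i)]
    [∀ i, Countable (Gf i)] :
    ∃ D : ℕ → Set (restrictedDirectProduct κ Gf),
      (∀ n, uDisparse (D n)) ∧ (⋃ n, D n) = Set.univ ∧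
      Pairwise (Function.onFun Disjoint D) := by
  classical
  choose e he using fun i => exists_injective_nat (Gf i)
  let s : restrictedDirectProduct κ Gf → Finset κ := fun x => Set.Finite.toFinset x.2
  let c : restrictedDirectProduct κ Gf → ℕ := fun x =>
    Nat.pair {i | x.1 i ≠ 1}.ncard ((s x).sup fun i => e i (x.1 i))
  refine ⟨fun k => {x | c x = k}, ?_, ?_, ?_⟩
  · intro k
    apply uDisparse_of_sep
    apply sep_restricted κ Gf k.unpair.1
      (fun i => insert 1 (e i ⁻¹' Set.Iic k.unpair.2))
    · intro i
      exact ((Set.finite_Iic _).preimage (he i).injOn).insert 1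
    · rintro x rfl
      simp [c]
    · rintro x rfl i
      by_cases hi : x.1 i = 1
      · exact Or.inl hi
      · right
        have hmem : i ∈ s x := (Set.Finite.mem_toFinset _).2 hi
        have := Finset.le_sup (f := fun i => e i (x.1 i)) hmem
        simpa [c] using this
  · ext x
    simp
  · intro a b hab
    refine Set.disjoint_left.2 fun x hx hy => hab ?_
    exact hx.symm.trans hy
end
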